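/- For p + q = 1 and f(ξ,ξ') = p + qξξ' - ξ, the antisymmetrized sum over all permutations σ of {1,…,N}: ∑_σ sgn(σ) ∏_{i<j} f(ξ_{σ(i)}, ξ_{σ(j)}) · ξ_{σ(2)} ξ_{σ(3)}² ⋯ ξ_{σ(N)}^{N-1} / [(1 - ξ_{σ(1)}⋯ξ_{σ(N)})(1 - ξ_{σ(2)}⋯ξ_{σ(N)})⋯(1 - ξ_{σ(N)})] equals p^{N(N-1)/2} ∏_{i<j}(ξ_j - ξ_i) / ∏_i (1 - ξ_i). -/

import Mathlib

open Finset

lemma asep_generic (T : Finset ℂ) (p q r : ℂ) (hpq : p + q = 1) (hq : q ≠ 0) (hp : p ≠ 0)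
    (hr : q * r = p) (hrT : r ∉ T) (h0 : (0 : ℂ) ∉ T) :
    ∑ x ∈ T, (1 - x) * ∏ y ∈ T.erase x, ((p + q * x * y - x) * y / (y - x))
      = p ^ (#T - 1) * (1 - ∏ y ∈ T, y) := by
  classical
  rcases T.eq_empty_or_nonempty with rfl | hT
  · simp
  have hr0 : r ≠ 0 := by rintro rfl; simp at hr; exact hp hr.symm
  have h0' : (0 : ℂ) ∉ insert r T := by simp [h0, hr0.symm]
  have hE : ∏ y ∈ T, y ≠ 0 := Finset.prod_ne_zero_iff.2 fun y hy h => h0 (h ▸ hy)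
  have hcard : #(insert 0 (insert r T)) = #T + 2 := by
    rw [card_insert_of_notMem h0', card_insert_of_notMem hrT]
  let P : Polynomial ℂ := ∏ y ∈ T, (Polynomial.C p + Polynomial.C (q * y - 1) * Polynomial.X)
  have hPe : ∀ x, P.eval x = ∏ y ∈ T, (p + q * x * y - x) := by
    intro x
    simp only [P, Polynomial.eval_prod]
    refine prod_congr rfl fun y _ => ?_
    simp; ring
  have hdeg : P.natDegree ≤ #T := by
    refine (Polynomial.natDegree_prod_le _ _).trans ?_
    rw [card_eq_sum_ones]
    refine sum_le_sum fun y _ => ?_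
    compute_degree
  have key := Lagrange.coeff_eq_sum (s := insert 0 (insert r T)) (v := id)
    (Function.injective_id.injOn) (P := P) (by
      rw [hcard]
      refine lt_of_le_of_lt Polynomial.degree_le_natDegree ?_
      exact_mod_cast (by omega))
  rw [hcard, Polynomial.coeff_eq_zero_of_natDegree_lt (by omega), sum_insert h0', sum_insert hrT,
    erase_insert h0', prod_insert hrT] at key
  have e1 : (insert 0 (insert r T)).erase r = insert 0 T := by
    ext z; simp only [mem_erase, mem_insert]
    constructor
    · tauto
    · rintro (rfl | h)
      · exact ⟨hr0.symm, Or.inl rfl⟩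
      · exact ⟨fun h' => hrT (h' ▸ h), Or.inr (Or.inr h)⟩
  rw [e1, prod_insert h0] at key
  simp only [id, hPe] at key
  have hP0 : ∏ y ∈ T, (p + q * 0 * y - 0) = p ^ #T := by simp
  have hPr : ∏ y ∈ T, (p + q * r * y - r) = p ^ #T * ((-1) ^ #T * ∏ y ∈ T, (r - y)) := by
    rw [← prod_const, ← prod_const, ← prod_mul_distrib, ← prod_mul_distrib]
    refine prod_congr rfl fun y _ => ?_
    linear_combination (y - 1) * hr + r * hpq
  have hz : ∏ y ∈ T, (0 - y) = (-1) ^ #T * ∏ y ∈ T, y := by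
    rw [← prod_const, ← prod_mul_distrib]
    exact prod_congr rfl fun y _ => by ring
  have hrne : ∏ y ∈ T, (r - y) ≠ 0 :=
    Finset.prod_ne_zero_iff.2 fun y hy h => hrT ((sub_eq_zero.1 h) ▸ hy)
  have hterm : ∀ x ∈ T, (∏ y ∈ T, (p + q * x * y - x)) /
      (∏ y ∈ (insert 0 (insert r T)).erase x, (x - y)) =
      (-1) ^ #T * q / (∏ y ∈ T, y) *
        ((1 - x) * ∏ y ∈ T.erase x, ((p + q * x * y - x) * y / (y - x))) := by
    intro x hx
    have hx0 : x ≠ 0 := fun h => h0 (h ▸ hx)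
    have hxr : x ≠ r := fun h => hrT (h ▸ hx)
    rw [erase_insert_of_ne hx0.symm, erase_insert_of_ne hxr.symm, prod_insert, prod_insert]
    rotate_left
    · simp [hrT]
    · simp [h0, hr0.symm]
    have hne : ∏ y ∈ T.erase x, (x - y) ≠ 0 :=
      Finset.prod_ne_zero_iff.2 fun y hy h => (mem_erase.1 hy).1 (sub_eq_zero.1 h).symm
    have hsgn : ∏ y ∈ T.erase x, (y - x) = (-1) ^ (#T - 1) * ∏ y ∈ T.erase x, (x - y) := by
      rw [← card_erase_of_mem hx, ← prod_const, ← prod_mul_distrib]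
      exact prod_congr rfl fun y _ => by ring
    rw [prod_div_distrib, prod_mul_distrib, hsgn, ← mul_prod_erase T _ hx,
      ← mul_prod_erase T (fun y => y) hx]
    rw [← mul_prod_erase T (fun y => y) hx] at hE
    have hE' := right_ne_zero_of_mul hE
    have hfx : p + q * x * x - x = - q * (1 - x) * (x - r) := by
      linear_combination x * hpq - (1 - x) * hr 
    rw [hfx]
    obtain ⟨m, hm⟩ : ∃ m, #T = m + 1 := ⟨#T - 1, by have := hT.card_pos; omega⟩
    rw [hm, Nat.add_sub_cancel]
    have hxr' : x - r ≠ 0 := sub_ne_zero.2 hxr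
    have h1 : ((-1 : ℂ) ^ m) ≠ 0 := by simp
    rw [sub_zero, pow_succ]
    field_simp
  rw [sum_congr rfl hterm, ← mul_sum, hP0, hPr, hz] at key
  obtain ⟨m, hm⟩ : ∃ m, #T = m + 1 := ⟨#T - 1, by have := hT.card_pos; omega⟩
  rw [hm] at key ⊢
  rw [Nat.add_sub_cancel]
  generalize (∑ x ∈ T, (1 - x) * ∏ y ∈ T.erase x, ((p + q * x * y - x) * y / (y - x))) = S at *
  generalize ∏ y ∈ T, (r - y) = R at *
  generalize ∏ y ∈ T, y = E at *
  subst hr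
  have h1 : ((-1 : ℂ) ^ (m+1)) ≠ 0 := by simp
  have hs : ((-1 : ℂ) ^ (m+1)) * ((-1 : ℂ) ^ (m+1)) = 1 := by rw [← mul_pow]; simp
  generalize ((-1 : ℂ) ^ (m+1)) = e at *
  rw [sub_zero, zero_sub, pow_succ] at key
  generalize (q * r) ^ m = w at *
  have hs2 : e ^ 2 = 1 := by rw [← hs]; ring
  field_simp at key
  rw [hs2] at key
  exact mul_left_cancel₀ hq (by linear_combination -key)

lemma asep_sum (T : Finset ℂ) (p q : ℂ) (hpq : p + q = 1) :
    ∑ x ∈ T, (1 - x) * ∏ y ∈ T.erase x, ((p + q * x * y - x) * y / (y - x))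
      = p ^ (#T - 1) * (1 - ∏ y ∈ T, y) := by
  classical
  by_cases h0 : (0 : ℂ) ∈ T
  · rw [sum_eq_single_of_mem 0 h0, prod_eq_zero h0 rfl]
    · rw [← card_erase_of_mem h0, ← prod_const]
      simp only [sub_zero, mul_one, one_mul]
      refine prod_congr rfl fun y hy => ?_
      have := (mem_erase.1 hy).1
      field_simp
      ring
    · intro x hx hx0
      rw [prod_eq_zero (mem_erase.2 ⟨hx0.symm, h0⟩), mul_zero]
      simp
  obtain rfl : q = 1 - p := by linear_combination hpq
  let B : Set ℂ := ({0, 1} ∪ T.image (fun x => x / (1 + x)) : Finset ℂ)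
  have hB : Dense Bᶜ := by
    have := Dense.sdiff_finset (dense_univ (X := ℂ)) ({0, 1} ∪ T.image (fun x => x / (1 + x)))
    rwa [← Set.compl_eq_univ_sdiff] at this
  have hc := Continuous.ext_on hB
    (f := fun p : ℂ => ∑ x ∈ T, (1 - x) * ∏ y ∈ T.erase x, ((p + (1 - p) * x * y - x) * y / (y - x)))
    (g := fun p : ℂ => p ^ (#T - 1) * (1 - ∏ y ∈ T, y)) (by fun_prop) (by fun_prop) (by
      intro p hp
      simp only [B, Set.mem_compl_iff, mem_coe, mem_union, mem_insert, mem_singleton, mem_image,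
        not_or, not_exists, not_and] at hp
      have hq : 1 - p ≠ 0 := sub_ne_zero.2 (Ne.symm hp.1.2)
      refine asep_generic T p (1 - p) (p / (1 - p)) (by ring) hq hp.1.1 (by field_simp) ?_ h0
      intro h
      refine hp.2 _ h ?_
      field_simp
      ring)
  exact congrFun hc p

lemma asep_sum_fin (n : ℕ) (ξ : Fin (n + 1) → ℂ) (hinj : Function.Injective ξ) (p q : ℂ)
    (hpq : p + q = 1) :
    ∑ k, (1 - ξ k) * ∏ j : Fin n, ((p + q * ξ k * ξ (k.succAbove j) - ξ k) * ξ (k.succAbove j) /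
      (ξ (k.succAbove j) - ξ k)) = p ^ n * (1 - ∏ k, ξ k) := by
  classical
  have := asep_sum (univ.image ξ) p q hpq
  rw [card_image_of_injective _ hinj, sum_image hinj.injOn, prod_image hinj.injOn] at this
  simp only [card_univ, Fintype.card_fin, Nat.add_sub_cancel] at this
  rw [← this]
  refine sum_congr rfl fun k _ => ?_
  congr 1
  rw [← image_erase hinj, prod_image hinj.injOn]
  have : univ.erase k = univ.image k.succAbove := by
    ext x; simp [Fin.exists_succAbove_eq_iff]
  rw [this, prod_image (Fin.succAbove_right_injective.injOn)]

/-- Decomposition of a permutation by the image of zero. -/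
def asepPerm {n : ℕ} (x : Fin (n + 1) × Equiv.Perm (Fin n)) : Equiv.Perm (Fin (n + 1)) :=
  x.1.cycleRange.symm * Equiv.Perm.decomposeFin.symm (0, x.2)

lemma asepPerm_zero {n : ℕ} (x : Fin (n + 1) × Equiv.Perm (Fin n)) : asepPerm x 0 = x.1 := by
  simp [asepPerm]

lemma asepPerm_succ {n : ℕ} (x : Fin (n + 1) × Equiv.Perm (Fin n)) (j : Fin n) :
    asepPerm x j.succ = x.1.succAbove (x.2 j) := by
  simp [asepPerm]

lemma asepPerm_sign {n : ℕ} (x : Fin (n + 1) × Equiv.Perm (Fin n)) :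
    Equiv.Perm.sign (asepPerm x) = (-1) ^ (x.1 : ℕ) * Equiv.Perm.sign x.2 := by
  simp [asepPerm]

lemma asepPerm_bij {n : ℕ} : Function.Bijective (asepPerm (n := n)) := by
  rw [Fintype.bijective_iff_injective_and_card]
  refine ⟨?_, by simp [Fintype.card_perm, Nat.factorial_succ]⟩
  rintro ⟨k, τ⟩ ⟨k', τ'⟩ h
  have h1 : k = k' := by simpa [asepPerm_zero] using congrArg (fun σ => σ 0) h
  subst h1
  have h2 := mul_left_cancel h
  simpa using h2

lemma asep_vandermonde {n : ℕ} (ξ : Fin (n + 1) → ℂ) (k : Fin (n + 1)) :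
    (∏ i, ∏ j ∈ Ioi i, (ξ j - ξ i)) =
      (-1) ^ (k : ℕ) * ((∏ j : Fin n, (ξ (k.succAbove j) - ξ k)) *
        ∏ i : Fin n, ∏ j ∈ Ioi i, (ξ (k.succAbove j) - ξ (k.succAbove i))) := by
  have h := Matrix.det_permute k.cycleRange.symm (Matrix.vandermonde ξ)
  have h2 : (Matrix.vandermonde ξ).submatrix k.cycleRange.symm id =
    Matrix.vandermonde (fun i => ξ (k.cycleRange.symm i)) := rfl
  rw [h2, Matrix.det_vandermonde, Matrix.det_vandermonde, Fin.prod_univ_succ] at h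
  simp only [Fin.prod_Ioi_zero, Fin.prod_Ioi_succ, Fin.cycleRange_symm_succ,
    Fin.cycleRange_symm_zero, Equiv.Perm.sign_symm, Fin.sign_cycleRange] at h
  rw [h]
  push_cast
  rw [← mul_assoc, ← mul_pow]
  simp

/-- Identity (1.6) of Tracy–Widom: the antisymmetrized sum over all permutations σ of
sgn(σ) ∏_{i<j} f(ξ_{σ(i)},ξ_{σ(j)}) · ξ_{σ(2)}ξ_{σ(3)}²⋯ξ_{σ(N)}^{N−1} /
[(1−ξ_{σ(1)}⋯ξ_{σ(N)})⋯(1−ξ_{σ(N)})]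
equals p^{N(N−1)/2} ∏_{i<j}(ξ_j−ξ_i)/∏_i(1−ξ_i), where f(ξ,ξ') = p + qξξ' − ξ. -/
theorem asep_identity_one (N : ℕ) (p q : ℂ) (hpq : p + q = 1)
    (ξ : Fin N → ℂ) (hξ1 : ∀ i, ξ i ≠ 1)
    (hden : ∀ (σ : Equiv.Perm (Fin N)) (k : Fin N),
      (∏ j ∈ Finset.Ici k, ξ (σ j)) ≠ 1) :
    ∑ σ : Equiv.Perm (Fin N),
        ((Equiv.Perm.sign σ : ℤ) : ℂ) *
          ((∏ i : Fin N, ∏ j ∈ Finset.Ioi i,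
              (p + q * ξ (σ i) * ξ (σ j) - ξ (σ i))) *
            (∏ i : Fin N, ξ (σ i) ^ (i : ℕ)) /
            ∏ k : Fin N, (1 - ∏ j ∈ Finset.Ici k, ξ (σ j)))
      = p ^ (N * (N - 1) / 2) *
          (∏ i : Fin N, ∏ j ∈ Finset.Ioi i, (ξ j - ξ i)) /
          ∏ i : Fin N, (1 - ξ i) := by
  induction N with
  | zero => simp
  | succ n ih =>
  by_cases hinj : Function.Injective ξ
  swap
  · -- both sides vanish
    obtain ⟨a, b, hab, hne⟩ := Function.not_injective_iff.1 hinj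
    have hV : (∏ i, ∏ j ∈ Finset.Ioi i, (ξ j - ξ i)) = 0 := by
      rw [← Matrix.det_vandermonde]
      exact Matrix.det_zero_of_row_eq hne (by funext j; simp [Matrix.vandermonde, hab])
    rw [hV]
    simp only [mul_zero, zero_div]
    have hsw : ∀ x, ξ (Equiv.swap a b x) = ξ x := by
      intro x
      rcases eq_or_ne x a with rfl | hxa
      · simp [hab]
      rcases eq_or_ne x b with rfl | hxb
      · simp [hab]
      rw [Equiv.swap_apply_of_ne_of_ne hxa hxb]
    rw [← self_eq_neg]
    conv_lhs => rw [← Equiv.sum_comp (Equiv.mulLeft (Equiv.swap a b))]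
    rw [← sum_neg_distrib]
    refine sum_congr rfl fun σ _ => ?_
    simp only [Equiv.coe_mulLeft, Equiv.Perm.mul_apply, hsw, Equiv.Perm.sign_mul,
      Equiv.Perm.sign_swap hne]
    push_cast
    ring
  rw [← Function.Bijective.sum_comp asepPerm_bij, Fintype.sum_prod_type]
  have hE : 1 - ∏ i, ξ i ≠ 0 := by
    have := hden 1 0
    rw [sub_ne_zero]
    intro h
    apply this
    rw [h]
    refine Finset.prod_congr ?_ fun _ _ => rfl
    ext; simp
  have hIci : Finset.Ici (0 : Fin (n + 1)) = univ := by ext; simp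
  have hterm : ∀ (k : Fin (n + 1)) (τ : Equiv.Perm (Fin n)),
      ((Equiv.Perm.sign (asepPerm (k, τ)) : ℤ) : ℂ) *
          ((∏ i : Fin (n + 1), ∏ j ∈ Finset.Ioi i,
              (p + q * ξ (asepPerm (k, τ) i) * ξ (asepPerm (k, τ) j) - ξ (asepPerm (k, τ) i))) *
            (∏ i : Fin (n + 1), ξ (asepPerm (k, τ) i) ^ (i : ℕ)) /
            ∏ k' : Fin (n + 1), (1 - ∏ j ∈ Finset.Ici k', ξ (asepPerm (k, τ) j)))
      = ((-1) ^ (k : ℕ) * (∏ j : Fin n, ((p + q * ξ k * ξ (k.succAbove j) - ξ k) *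
            ξ (k.succAbove j))) / (1 - ∏ i, ξ i)) *
        (((Equiv.Perm.sign τ : ℤ) : ℂ) *
          ((∏ i : Fin n, ∏ j ∈ Finset.Ioi i,
              (p + q * ξ (k.succAbove (τ i)) * ξ (k.succAbove (τ j)) - ξ (k.succAbove (τ i)))) *
            (∏ i : Fin n, ξ (k.succAbove (τ i)) ^ (i : ℕ)) /
            ∏ k' : Fin n, (1 - ∏ j ∈ Finset.Ici k', ξ (k.succAbove (τ j))))) := by
    intro k τ
    rw [asepPerm_sign, Fin.prod_univ_succ, Fin.prod_univ_succ (n := n) (f := fun i => _ ^ _),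
      Fin.prod_univ_succ (n := n) (f := fun i => 1 - _), hIci,
      Equiv.prod_comp (asepPerm (k, τ)) ξ]
    simp only [Fin.prod_Ioi_zero, Fin.prod_Ioi_succ, Fin.prod_Ici_succ, asepPerm_succ,
      asepPerm_zero, Fin.val_zero, pow_zero, one_mul, Fin.val_succ, pow_succ, prod_mul_distrib]
    rw [Equiv.prod_comp τ (fun j => (p + q * ξ k * ξ (k.succAbove j) - ξ k)),
      Equiv.prod_comp τ (fun j => ξ (k.succAbove j))]
    push_cast
    simp only [div_eq_mul_inv, mul_inv]
    ring
  simp only [hterm, ← mul_sum]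
  have hI : ∀ k : Fin (n + 1), _ := fun k => ih (fun i => ξ (k.succAbove i)) (fun i => hξ1 _)
    (by
      intro τ i
      have := hden (asepPerm (k, τ)) i.succ
      simpa only [Fin.prod_Ici_succ, asepPerm_succ] using this)
  simp only [hI]
  have hpw : (n + 1) * (n + 1 - 1) / 2 = n + n * (n - 1) / 2 := by
    cases n with
    | zero => rfl
    | succ m =>
      simp only [Nat.add_sub_cancel]
      rw [show (m + 1 + 1) * (m + 1) = (m + 1) * m + (m + 1) * 2 by ring,
        Nat.add_mul_div_right _ _ (by norm_num)]
      ring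
  have hone : ∀ i, 1 - ξ i ≠ 0 := fun i => sub_ne_zero.2 (hξ1 i).symm
  have hD : ∏ i, (1 - ξ i) ≠ 0 := prod_ne_zero_iff.2 fun i _ => hone i
  have hs := asep_sum_fin n ξ hinj p q hpq
  rw [hpw, pow_add]
  have hfin : ∀ k : Fin (n + 1),
      ((-1) ^ (k : ℕ) * (∏ j : Fin n, ((p + q * ξ k * ξ (k.succAbove j) - ξ k) *
            ξ (k.succAbove j))) / (1 - ∏ i, ξ i)) *
        (p ^ (n * (n - 1) / 2) *
          (∏ i : Fin n, ∏ j ∈ Finset.Ioi i, (ξ (k.succAbove j) - ξ (k.succAbove i))) /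
          ∏ i : Fin n, (1 - ξ (k.succAbove i))) =
      p ^ (n * (n - 1) / 2) * (∏ i, ∏ j ∈ Finset.Ioi i, (ξ j - ξ i)) / (∏ i, (1 - ξ i)) /
        (1 - ∏ i, ξ i) * ((1 - ξ k) * ∏ j : Fin n, ((p + q * ξ k * ξ (k.succAbove j) - ξ k) *
          ξ (k.succAbove j) / (ξ (k.succAbove j) - ξ k))) := by
    intro k
    have hd : ∏ j : Fin n, (ξ (k.succAbove j) - ξ k) ≠ 0 :=
      prod_ne_zero_iff.2 fun j _ => sub_ne_zero.2 fun h => Fin.succAbove_ne k j (hinj h)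
    have hd2 : ∏ i : Fin n, (1 - ξ (k.succAbove i)) ≠ 0 := prod_ne_zero_iff.2 fun i _ => hone _
    have hk := hone k
    rw [asep_vandermonde ξ k, Fin.prod_univ_succAbove (fun i => 1 - ξ i) k, prod_div_distrib]
    field_simp
  rw [sum_congr rfl fun k _ => hfin k, ← mul_sum, hs]
  field_simp
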